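/- For every integer n ≥ 3, the Mycielskian of the cycle C_n satisfies gp(μ(C_n)) = n + 1 if n = 3 or n = 5, and gp(μ(C_n)) = n otherwise. -/

import Mathlib

open SimpleGraph

variable {V : Type*}

/-- The Mycielskian of a graph `G`: vertices are `some (Sum.inl v)` (original vertices),
`some (Sum.inr v)` (twin vertices), and `none` (the root `u*`). -/
def Mycielskian (G : SimpleGraph V) : SimpleGraph (Option (V ⊕ V)) :=
  SimpleGraph.fromRel (fun x y =>
    (∃ u v, G.Adj u v ∧ x = some (Sum.inl u) ∧ y = some (Sum.inl v)) ∨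
    (∃ u v, G.Adj u v ∧ x = some (Sum.inl u) ∧ y = some (Sum.inr v)) ∨
    (∃ u, x = some (Sum.inr u) ∧ y = none))

/-- `S` is a general position set: no shortest path between two vertices of `S`
contains a third element of `S`. -/
def IsGPSet (G : SimpleGraph V) (S : Set V) : Prop :=
  ∀ u ∈ S, ∀ v ∈ S, ∀ p : G.Walk u v, p.length = G.dist u v →
    ∀ w ∈ S, w ∈ p.support → w = u ∨ w = v

/-- The general position number of `G`: the maximum cardinality of a general position set. -/
noncomputable def gpNumber (G : SimpleGraph V) [Fintype V] : ℕ :=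
  sSup {k | ∃ S : Set V, IsGPSet G S ∧ S.ncard = k}

/-- A gp-set: a general position set of maximum cardinality. -/
def IsGpSet (G : SimpleGraph V) [Fintype V] (S : Set V) : Prop :=
  IsGPSet G S ∧ S.ncard = gpNumber G

variable {G : SimpleGraph V}

@[simp] lemma mycielskian_adj_inl_inl {u v : V} :
    (Mycielskian G).Adj (some (.inl u)) (some (.inl v)) ↔ G.Adj u v := by
  simp only [Mycielskian, SimpleGraph.fromRel_adj]
  have := G.adj_comm u v
  have := @SimpleGraph.Adj.ne _ G u v
  simp
  grind

@[simp] lemma mycielskian_adj_inl_inr {u v : V} :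
    (Mycielskian G).Adj (some (.inl u)) (some (.inr v)) ↔ G.Adj u v := by
  simp [Mycielskian, SimpleGraph.fromRel_adj]

@[simp] lemma mycielskian_adj_inr_inl {u v : V} :
    (Mycielskian G).Adj (some (.inr u)) (some (.inl v)) ↔ G.Adj v u := by
  simp [Mycielskian, SimpleGraph.fromRel_adj]

@[simp] lemma mycielskian_not_adj_inr_inr {u v : V} :
    ¬ (Mycielskian G).Adj (some (.inr u)) (some (.inr v)) := by
  simp [Mycielskian, SimpleGraph.fromRel_adj]

@[simp] lemma mycielskian_adj_inr_none {u : V} :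
    (Mycielskian G).Adj (some (.inr u)) none := by
  simp [Mycielskian, SimpleGraph.fromRel_adj]

@[simp] lemma mycielskian_adj_none_inr {u : V} :
    (Mycielskian G).Adj none (some (.inr u)) :=
  mycielskian_adj_inr_none.symm

@[simp] lemma mycielskian_not_adj_inl_none {u : V} :
    ¬ (Mycielskian G).Adj (some (.inl u)) none := by
  simp [Mycielskian, SimpleGraph.fromRel_adj]

@[simp] lemma mycielskian_not_adj_none_inl {u : V} :
    ¬ (Mycielskian G).Adj none (some (.inl u)) :=
  fun h => mycielskian_not_adj_inl_none h.symm

/-- In a general position set, two neighbours of an element are equal or adjacent. -/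
lemma IsGPSet.eq_or_adj_of_adj {S : Set V} (hS : IsGPSet G S) {x y z : V} (hx : x ∈ S)
    (hy : y ∈ S) (hz : z ∈ S) (hyx : G.Adj y x) (hyz : G.Adj y z) : x = z ∨ G.Adj x z := by
  by_contra! h
  let p : G.Walk x z := .cons hyx.symm (.cons hyz .nil)
  have hp : p.length = G.dist x z := by
    have h2 : G.dist x z ≤ 2 := dist_le p
    have h0 : G.dist x z ≠ 0 := fun h0 => h.1 (p.reachable.dist_eq_zero_iff.1 h0)
    have h1 : G.dist x z ≠ 1 := fun h1 => h.2 (dist_eq_one_iff_adj.1 h1)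
    change 2 = _
    omega
  rcases hS x hx z hz p hp y hy (by simp [p]) with h | h
  · exact hyx.ne h
  · exact hyz.ne h

/-- In a general position set, the second vertex of a walk `x, y, w, z` lies outside the set when
`x` and `z` are at distance three. -/
lemma IsGPSet.exists_common_neighbor {S : Set V} (hS : IsGPSet G S) {x y w z : V} (hx : x ∈ S)
    (hy : y ∈ S) (hz : z ∈ S) (hxy : G.Adj x y) (hyw : G.Adj y w) (hwz : G.Adj w z)
    (hyz : y ≠ z) : x = z ∨ G.Adj x z ∨ ∃ t, G.Adj x t ∧ G.Adj t z := by
  by_contra! h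
  let p : G.Walk x z := .cons hxy (.cons hyw (.cons hwz .nil))
  have hp : p.length = G.dist x z := by
    have h3 : G.dist x z ≤ 3 := dist_le p
    have h0 : G.dist x z ≠ 0 := fun h0 => h.1 (p.reachable.dist_eq_zero_iff.1 h0)
    have h1 : G.dist x z ≠ 1 := fun h1 => h.2.1 (dist_eq_one_iff_adj.1 h1)
    have h2 : G.dist x z ≠ 2 := by
      intro h2
      obtain ⟨q, hq⟩ := p.reachable.exists_walk_length_eq_dist
      rw [h2] at hq
      match q, hq with
      | .cons ha (.cons hb .nil), _ => exact h.2.2 _ ha hb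
    change 3 = _
    omega
  rcases hS x hx z hz p hp y hy (by simp [p]) with h | h
  · exact hxy.ne h.symm
  · exact hyz h

/-- A criterion for general position of sets of diameter at most two. -/
lemma isGPSet_of_common_neighbor {S : Set V}
    (hd : ∀ u ∈ S, ∀ v ∈ S, u = v ∨ G.Adj u v ∨ ∃ t, G.Adj u t ∧ G.Adj t v)
    (h : ∀ u ∈ S, ∀ w ∈ S, ∀ v ∈ S, G.Adj u w → G.Adj w v → u = v ∨ G.Adj u v) :
    IsGPSet G S := by
  intro u hu v hv p hp w hw hwp
  have h2 : p.length ≤ 2 := by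
    rw [hp]
    rcases hd u hu v hv with rfl | ha | ⟨t, ha, hb⟩
    · simp
    · exact (dist_eq_one_iff_adj.2 ha).le.trans one_le_two
    · exact dist_le (.cons ha (.cons hb .nil))
  match p, hp, h2 with
  | .nil, _, _ => simp_all
  | .cons _ .nil, _, _ => simpa using hwp
  | .cons (v := t) ha (.cons hb .nil), hp, _ =>
    by_contra! hne
    obtain rfl : w = t := by simpa [hne.1, hne.2] using hwp
    rcases h u hu w hw v hv ha hb with rfl | hadj
    · simp at hp
    · simp [dist_eq_one_iff_adj.2 hadj] at hp
  | .cons _ (.cons _ (.cons _ _)), _, h2 => simp at h2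

/-- A set of vertices of the Mycielskian without the root is counted by its original vertices and
its twins. -/
lemma ncard_le_card_add_card [Fintype V] (S : Set (Option (V ⊕ V))) {A B : Finset V}
    (hA : ∀ i, some (.inl i) ∈ S → i ∈ A) (hB : ∀ i, some (.inr i) ∈ S → i ∈ B) :
    (S \ {none}).ncard ≤ A.card + B.card := by
  classical
  rw [← Finset.card_disjSum, ← Set.ncard_coe_finset,
    ← Set.ncard_image_of_injective (A.disjSum B : Set (V ⊕ V)) (Option.some_injective _)]
  refine Set.ncard_le_ncard ?_ (Set.toFinite _)
  rintro (_ | i | i) ⟨hi, hne⟩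
  · simp at hne
  · simpa using hA i hi
  · simpa using hB i hi

/-! In a finite ring `R` of characteristic `n = |R|`, the relation of differing by one is the
cycle graph on `n` vertices. -/

section cycle

variable {R : Type*} [CommRing R] {C : SimpleGraph R} {S : Set (Option (R ⊕ R))}

/-- No general position set contains an original vertex, one of its neighbours and the twin
of that neighbour. -/
lemma IsGPSet.notMem_of_twin_mem {S : Set (Option (V ⊕ V))} (hS : IsGPSet (Mycielskian G) S)
    {a b : V} (hab : G.Adj a b) (ha : some (.inl a) ∈ S) (hb : some (.inr b) ∈ S) :
    some (.inl b) ∉ S := by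
  intro hb'
  have := hS.eq_or_adj_of_adj hb ha hb' (by simpa using hab) (by simpa using hab)
  simp at this

/-- At most one neighbouring twin of an original vertex of a general position set belongs to
the set. -/
lemma IsGPSet.twin_eq_of_adj {S : Set (Option (V ⊕ V))} (hS : IsGPSet (Mycielskian G) S)
    {a b c : V} (hab : G.Adj a b) (hac : G.Adj a c) (ha : some (.inl a) ∈ S)
    (hb : some (.inr b) ∈ S) (hc : some (.inr c) ∈ S) : b = c := by
  have := hS.eq_or_adj_of_adj hb ha hc (by simpa using hab) (by simpa using hac)
  simpa using this

/-- At most one twin belongs to a general position set containing the root. -/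
lemma IsGPSet.twin_eq_of_root_mem {S : Set (Option (V ⊕ V))} (hS : IsGPSet (Mycielskian G) S)
    (h : none ∈ S) {a b : V} (ha : some (.inr a) ∈ S) (hb : some (.inr b) ∈ S) : a = b := by
  have := hS.eq_or_adj_of_adj ha h hb (by simp) (by simp)
  simpa using this

/-- On a cycle of length at least four, a general position set contains no three consecutive
original vertices. -/
lemma IsGPSet.notMem_add_two (hC : ∀ u v, C.Adj u v ↔ u = v + 1 ∨ v = u + 1)
    (h2 : (2 : R) ≠ 0) (h3 : (3 : R) ≠ 0) (hS : IsGPSet (Mycielskian C) S)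
    {i : R} (hi : some (.inl i) ∈ S) (hi1 : some (.inl (i + 1)) ∈ S) :
    some (.inl (i + 2)) ∉ S := by
  intro hi2
  have := hS.eq_or_adj_of_adj hi hi1 hi2 (by simp [hC])
    (by simp only [mycielskian_adj_inl_inl, hC]; grind)
  simp only [mycielskian_adj_inl_inl, hC, Option.some.injEq, Sum.inl.injEq] at this
  rcases this with h | h | h
  · exact h2 (by linear_combination -h)
  · exact h3 (by linear_combination -h)
  · exact h2 (by linear_combination 2 * h)

/-- If a general position set contains an original vertex `a` and the twin of `a + 1`, then
it contains only twins of vertices close to `a`. -/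
lemma IsGPSet.twin_near [DecidableEq R] (hC : ∀ u v, C.Adj u v ↔ u = v + 1 ∨ v = u + 1)
    (hS : IsGPSet (Mycielskian C) S) {a : R} (ha : some (.inl a) ∈ S)
    (hb : some (.inr (a + 1)) ∈ S) {c : R} (hc : some (.inr c) ∈ S) :
    c ∈ ({a - 2, a, a + 1, a + 2} : Finset R) := by
  by_contra! hne
  simp only [Finset.mem_insert, Finset.mem_singleton, not_or] at hne
  obtain ⟨hc1, hc2, hc3, hc4⟩ := hne
  by_cases hc5 : a = c + 1
  · exact hc3 (hS.twin_eq_of_adj (a := a) (by simp [hC, hc5]) (by simp [hC]) ha hc hb)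
  rcases hS.exists_common_neighbor ha hb hc (w := none) (by simp [hC])
      (by simp) (by simp) (by simpa using Ne.symm hc3) with h | h | ⟨t, h, h'⟩
  · simp at h
  · simp only [mycielskian_adj_inl_inr, hC] at h
    grind
  · match t, h, h' with
    | some (.inl t), h, h' =>
      simp only [mycielskian_adj_inl_inl, mycielskian_adj_inl_inr, hC] at h h'
      grind
    | some (.inr t), _, h' => simp at h'
    | none, h, _ => simp at h

variable [Fintype R] {n : ℕ} [CharP R n]

lemma natCast_ne_zero_of_charP_lt (R : Type*) [CommRing R] (n : ℕ) [CharP R n] {k : ℕ}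
    (h0 : 0 < k) (hk : k < n) : (k : R) ≠ 0 := by
  rw [Ne, CharP.cast_eq_zero_iff R n]
  exact Nat.not_dvd_of_pos_of_lt h0 hk

lemma IsGPSet.ncard_sdiff_le_of_twin_mem (hC : ∀ u v, C.Adj u v ↔ u = v + 1 ∨ v = u + 1)
    (hn : 3 ≤ n) (hR : Fintype.card R = n) (hS : IsGPSet (Mycielskian C) S) {a : R}
    (ha : some (.inl a) ∈ S) (hb : some (.inr (a + 1)) ∈ S) :
    (S \ {none}).ncard ≤ if n = 3 ∨ n = 5 then n + 1 else n := by
  classical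
  have h1 : (1 : R) ≠ 0 := mod_cast natCast_ne_zero_of_charP_lt R n (k := 1) (by omega) (by omega)
  have h2 : (2 : R) ≠ 0 := mod_cast natCast_ne_zero_of_charP_lt R n (k := 2) (by omega) (by omega)
  have hA1 : some (.inl (a + 1)) ∉ S := hS.notMem_of_twin_mem (by simp [hC]) ha hb
  have hB : ∀ c, some (.inr c) ∈ S → c ∈ ({a - 2, a, a + 1, a + 2} : Finset R) :=
    fun c => hS.twin_near hC ha hb
  have hB4 : ({a - 2, a, a + 1, a + 2} : Finset R).card ≤ 4 := Finset.card_le_four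
  obtain rfl | hn := hn.eq_or_lt
  · have h3 : (3 : R) = 0 := mod_cast CharP.cast_eq_zero R 3
    have hB' : some (.inr (a + 2)) ∉ S := fun h => h1 <| by
      have := hS.twin_eq_of_adj (a := a) (by grind) (by grind) ha hb h
      grind
    have h := ncard_le_card_add_card S (A := {a + 1}ᶜ) (B := {a, a + 1})
      (by simp; grind) (by simp at hB ⊢; grind)
    have : ({a, a + 1} : Finset R).card ≤ 2 := Finset.card_le_two
    rw [Finset.card_compl, Finset.card_singleton] at h
    simp
    omega
  have h3 : (3 : R) ≠ 0 := mod_cast natCast_ne_zero_of_charP_lt R n (k := 3) (by omega) (by omega)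
  have hA2 : some (.inl (a + 2)) ∉ S := by
    intro h
    have := hS.eq_or_adj_of_adj ha hb h (by simp [hC])
      (by simp only [mycielskian_adj_inr_inl, hC]; grind)
    simp only [mycielskian_adj_inl_inl, hC, Option.some.injEq, Sum.inl.injEq] at this
    rcases this with h | h | h
    · exact h2 (by linear_combination -h)
    · exact h3 (by linear_combination -h)
    · exact h2 (by linear_combination 2 * h)
  have hA3 : some (.inl (a - 1)) ∉ S := by
    intro h
    have := hS.eq_or_adj_of_adj hb ha h (by simp [hC])
      (by simp only [mycielskian_adj_inl_inl, hC]; grind)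
    simp only [mycielskian_adj_inr_inl, hC, Option.some.injEq, reduceCtorEq, false_or] at this
    rcases this with h | h
    · exact h3 (by linear_combination -h)
    · exact h1 (by linear_combination h)
  have hcard : ({a - 1, a + 1, a + 2} : Finset R).card = 3 :=
    Finset.card_eq_three.2 ⟨_, _, _, fun h => h2 (by linear_combination -h),
      fun h => h3 (by linear_combination -h), fun h => h1 (by linear_combination -h), rfl⟩
  have hA : ∀ i, some (.inl i) ∈ S → i ∈ ({a - 1, a + 1, a + 2} : Finset R)ᶜ := by
    simp
    grind
  obtain rfl | hn := (Nat.succ_le_of_lt hn).eq_or_lt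
  · have h4 : (4 : R) = 0 := mod_cast CharP.cast_eq_zero R 4
    have h := ncard_le_card_add_card S hA (B := {a, a + 1, a + 2}) (by simp at hB ⊢; grind)
    have : ({a, a + 1, a + 2} : Finset R).card ≤ 3 := Finset.card_le_three
    rw [Finset.card_compl] at h
    simp
    omega
  have h4 : (4 : R) ≠ 0 := mod_cast natCast_ne_zero_of_charP_lt R n (k := 4) (by omega) (by omega)
  have h := ncard_le_card_add_card S hA hB
  rw [Finset.card_compl] at h
  obtain rfl | hn := (Nat.succ_le_of_lt hn).eq_or_lt
  · simp
    omega
  have h5 : (5 : R) ≠ 0 := mod_cast natCast_ne_zero_of_charP_lt R n (k := 5) (by omega) (by omega)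
  rw [if_neg (by omega)]
  by_cases hB2 : some (.inr (a + 2)) ∈ S
  · obtain ⟨x, hx, hxS⟩ : ∃ x, (x = a + 3 ∨ x = a + 4) ∧ some (.inl x) ∉ S := by
      by_contra! hx
      have := hS.eq_or_adj_of_adj hB2 (hx (a + 3) (by simp)) (hx (a + 4) (by simp))
        (by simp only [mycielskian_adj_inl_inr, hC]; grind)
        (by simp only [mycielskian_adj_inl_inl, hC]; grind)
      simp only [mycielskian_adj_inr_inl, hC, Option.some.injEq, reduceCtorEq] at this
      grind
    have hx' : x ∉ ({a - 1, a + 1, a + 2} : Finset R) := by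
      simp only [Finset.mem_insert, Finset.mem_singleton, not_or]
      rcases hx with rfl | rfl
      · exact ⟨fun h => h4 (by linear_combination h), fun h => h2 (by linear_combination h),
          fun h => h1 (by linear_combination h)⟩
      · exact ⟨fun h => h5 (by linear_combination h), fun h => h3 (by linear_combination h),
          fun h => h2 (by linear_combination h)⟩
    have h := ncard_le_card_add_card S (A := (insert x {a - 1, a + 1, a + 2})ᶜ)
      (by simp at hA ⊢; grind) hB
    rw [Finset.card_compl, Finset.card_insert_of_notMem hx'] at h
    omega
  · have h := ncard_le_card_add_card S hA (B := {a - 2, a, a + 1}) (by simp at hB ⊢; grind)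
    have : ({a - 2, a, a + 1} : Finset R).card ≤ 3 := Finset.card_le_three
    rw [Finset.card_compl] at h
    omega

lemma IsGPSet.ncard_sdiff_le (hC : ∀ u v, C.Adj u v ↔ u = v + 1 ∨ v = u + 1)
    (hn : 3 ≤ n) (hR : Fintype.card R = n) (hS : IsGPSet (Mycielskian C) S) :
    (S \ {none}).ncard ≤ if n = 3 ∨ n = 5 then n + 1 else n := by
  classical
  by_cases hcase : ∃ a, some (.inl a) ∈ S ∧ some (.inr (a + 1)) ∈ S
  · obtain ⟨a, ha, hb⟩ := hcase
    exact hS.ncard_sdiff_le_of_twin_mem hC hn hR ha hb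
  · push Not at hcase
    let A : Finset R := {i | some (.inl i) ∈ S}
    have h := ncard_le_card_add_card S (A := A) (B := (A.image (· + 1))ᶜ) (by simp [A]) (by
      intro i hi
      simp only [Finset.mem_compl, Finset.mem_image, not_exists, not_and]
      rintro x hx rfl
      exact hcase x (by simpa [A] using hx) hi)
    rw [Finset.card_compl, Finset.card_image_of_injective _ (add_left_injective 1)] at h
    have := A.card_le_univ
    split_ifs <;> omega

lemma IsGPSet.ncard_sdiff_lt_of_root_mem (hC : ∀ u v, C.Adj u v ↔ u = v + 1 ∨ v = u + 1)
    (hn : 3 ≤ n) (hR : Fintype.card R = n) (hS : IsGPSet (Mycielskian C) S)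
    (hroot : none ∈ S) : (S \ {none}).ncard < if n = 3 then n + 1 else n := by
  classical
  have h1 : (1 : R) ≠ 0 := mod_cast natCast_ne_zero_of_charP_lt R n (k := 1) (by omega) (by omega)
  have h2 : (2 : R) ≠ 0 := mod_cast natCast_ne_zero_of_charP_lt R n (k := 2) (by omega) (by omega)
  obtain ⟨B, hB1, hB⟩ : ∃ B : Finset R, B.card ≤ 1 ∧ ∀ i, some (.inr i) ∈ S → i ∈ B :=
    ⟨Finset.univ.filter fun i => some (.inr i) ∈ S, Finset.card_le_one.2 (by
      simp only [Finset.mem_filter_univ]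
      exact fun i hi j hj => hS.twin_eq_of_root_mem hroot hi hj), by simp⟩
  obtain rfl | hn := hn.eq_or_lt
  · rw [if_pos rfl]
    by_cases hb : ∃ b, some (.inr b) ∈ S
    · obtain ⟨b, hb⟩ := hb
      obtain ⟨x, hx⟩ : ∃ x, some (.inl x) ∉ S := by
        by_contra! hx
        exact hS.notMem_of_twin_mem (a := b + 1) (by simp [hC]) (hx _) hb (hx _)
      have h := ncard_le_card_add_card S (A := {x}ᶜ) (by simp; grind) hB
      rw [Finset.card_compl, Finset.card_singleton] at h
      omega
    · push Not at hb
      have h := ncard_le_card_add_card S (A := .univ) (B := ∅) (by simp) (by simpa using hb)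
      rw [Finset.card_univ] at h
      simp at h
      omega
  have h3 : (3 : R) ≠ 0 := mod_cast natCast_ne_zero_of_charP_lt R n (k := 3) (by omega) (by omega)
  have key : ∀ i, ∃ x, (x = i ∨ x = i + 1 ∨ x = i + 2) ∧ some (.inl x) ∉ S := by
    intro i
    by_contra! hx
    exact hS.notMem_add_two hC h2 h3 (hx i (by simp)) (hx (i + 1) (by simp))
      (hx (i + 2) (by simp))
  obtain ⟨x, -, hx⟩ := key 0
  obtain ⟨y, hy', hy⟩ := key (x + 1)
  have hxy : x ≠ y := by
    rintro rfl
    rcases hy' with h | h | h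
    · exact h1 (by linear_combination -h)
    · exact h2 (by linear_combination -h)
    · exact h3 (by linear_combination -h)
  have h := ncard_le_card_add_card S (A := {x, y}ᶜ) (by simp; grind) hB
  rw [Finset.card_compl, Finset.card_pair hxy] at h
  rw [if_neg (by omega)]
  omega

lemma IsGPSet.ncard_le (hC : ∀ u v, C.Adj u v ↔ u = v + 1 ∨ v = u + 1)
    (hn : 3 ≤ n) (hR : Fintype.card R = n) (hS : IsGPSet (Mycielskian C) S) :
    S.ncard ≤ if n = 3 ∨ n = 5 then n + 1 else n := by
  by_cases hroot : none ∈ S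
  · have h := hS.ncard_sdiff_lt_of_root_mem hC hn hR hroot
    have := Set.ncard_sdiff_singleton_add_one hroot (Set.toFinite S)
    split_ifs at h ⊢ <;> omega
  · simpa [hroot] using hS.ncard_sdiff_le hC hn hR

end cycle

/-- The twins form a general position set. -/
lemma isGPSet_range_twin (G : SimpleGraph V) :
    IsGPSet (Mycielskian G) (Set.range fun v => some (.inr v)) := by
  apply isGPSet_of_common_neighbor
  · rintro _ ⟨u, rfl⟩ _ ⟨v, rfl⟩
    exact .inr (.inr ⟨none, by simp, by simp⟩)
  · rintro _ ⟨u, rfl⟩ _ ⟨w, rfl⟩ _ ⟨v, rfl⟩ h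
    simp at h

instance [DecidableRel G.Adj] : DecidableRel (Mycielskian G).Adj
  | some (.inl _), some (.inl _) => decidable_of_iff _ mycielskian_adj_inl_inl.symm
  | some (.inl _), some (.inr _) => decidable_of_iff _ mycielskian_adj_inl_inr.symm
  | some (.inr _), some (.inl _) => decidable_of_iff _ mycielskian_adj_inr_inl.symm
  | some (.inr _), some (.inr _) => isFalse mycielskian_not_adj_inr_inr
  | some (.inl _), none => isFalse mycielskian_not_adj_inl_none
  | some (.inr _), none => isTrue mycielskian_adj_inr_none
  | none, some (.inl _) => isFalse mycielskian_not_adj_none_inl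
  | none, some (.inr _) => isTrue mycielskian_adj_none_inr
  | none, none => isFalse (Mycielskian G).irrefl

lemma exists_isGPSet_cycle_three :
    ∃ S : Finset (Option (Fin 3 ⊕ Fin 3)), IsGPSet (Mycielskian (cycleGraph 3)) S ∧ S.card = 4 :=
  ⟨{none, some (.inl 0), some (.inl 1), some (.inl 2)},
    isGPSet_of_common_neighbor (by simp only [Finset.mem_coe]; decide)
      (by simp only [Finset.mem_coe]; decide), rfl⟩

lemma exists_isGPSet_cycle_five :
    ∃ S : Finset (Option (Fin 5 ⊕ Fin 5)), IsGPSet (Mycielskian (cycleGraph 5)) S ∧ S.card = 6 :=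
  ⟨{some (.inl 0), some (.inl 3), some (.inr 0), some (.inr 1), some (.inr 2), some (.inr 3)},
    isGPSet_of_common_neighbor (by simp only [Finset.mem_coe]; decide)
      (by simp only [Finset.mem_coe]; decide), rfl⟩

lemma exists_isGPSet_cycle (n : ℕ) :
    ∃ S, IsGPSet (Mycielskian (cycleGraph n)) S ∧
      S.ncard = if n = 3 ∨ n = 5 then n + 1 else n := by
  split_ifs with h
  · rcases h with rfl | rfl
    · obtain ⟨S, hS, hc⟩ := exists_isGPSet_cycle_three
      exact ⟨S, hS, by simpa using hc⟩
    · obtain ⟨S, hS, hc⟩ := exists_isGPSet_cycle_five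
      exact ⟨S, hS, by simpa using hc⟩
  · refine ⟨_, isGPSet_range_twin _, ?_⟩
    rw [← Set.image_univ, Set.ncard_image_of_injective _ fun u v h => by simpa using h]
    simp

open scoped Fin.CommRing in
lemma IsGPSet.ncard_le_of_cycle {n : ℕ} (hn : 3 ≤ n) {S : Set (Option (Fin n ⊕ Fin n))}
    (hS : IsGPSet (Mycielskian (cycleGraph n)) S) :
    S.ncard ≤ if n = 3 ∨ n = 5 then n + 1 else n := by
  obtain ⟨m, rfl⟩ := Nat.exists_eq_add_of_le' hn
  have : CharP (Fin (m + 3)) (m + 3) := ZMod.charP (m + 3)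
  refine hS.ncard_le (fun u v => ?_) hn (Fintype.card_fin _)
  rw [cycleGraph_adj, sub_eq_iff_eq_add', sub_eq_iff_eq_add']

/-- For `n ≥ 3`, `gp(μ(C_n)) = n + 1` if `n = 3` or `n = 5`, and
`gp(μ(C_n)) = n` otherwise. -/
theorem gpNumber_mycielskian_cycle (n : ℕ) (hn : 3 ≤ n) :
    gpNumber (Mycielskian (SimpleGraph.cycleGraph n)) =
      if n = 3 ∨ n = 5 then n + 1 else n := by
  refine IsGreatest.csSup_eq ⟨exists_isGPSet_cycle n, ?_⟩
  rintro k ⟨S, hS, rfl⟩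
  exact hS.ncard_le_of_cycle hn
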